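/- Let γ: [0,1] → ℝ^n be a non-degenerate C^n curve. Then there exist constants δ_0 > 0 and c_1 ≥ 1, depending only on γ and n, such that the following holds. Let J_1, ..., J_n be essentially disjoint closed subintervals of [0,1] with c(J_1) < ... < c(J_n) and diam(⋃_{j=1}^n J_j) ≤ δ_0, let Ξ be a measurable function supported on ⋃_{j=1}^n J_j with 1 ≤ |Ξ(t)| ≤ n for all t ∈ ⋃_{j=1}^n J_j, and let A be the n×n matrix whose j-th column is ∫_{J_j} γ'(u)·|Ξ(u)| du. Suppose R ≥ 1 and that for some index j_0 ∈ {1,...,n} one has |J_{j_0}| ≥ c_1·R^{-1}. Then for every vector v ∈ ℝ^n with |v_{j_0}| ≥ 1, one has |A·v| ≥ R^{-n}. -/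

import Mathlib

open Finset MeasureTheory

noncomputable section

/-- Non-degeneracy of a `C^n` curve `γ : [0,1] → ℝ^n`:
`det(γ'(t), γ''(t), …, γ^{(n)}(t)) ≠ 0` for every `t ∈ [0,1]`. -/
def NonDegenerate (n : ℕ) (γ : ℝ → (Fin n → ℝ)) : Prop :=
  ∀ t ∈ Set.Icc (0 : ℝ) 1,
    (Matrix.of fun (i j : Fin n) =>
      iteratedDerivWithin ((j : ℕ) + 1) γ (Set.Icc 0 1) t i).det ≠ 0

/-- `G 0, G 1, …, G k` are successive derivatives of each other within `K`. -/
def IsDerivChain (G : ℕ → ℝ → ℝ) (k : ℕ) (K : Set ℝ) : Prop :=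
  ∀ j < k, ∀ t ∈ K, HasDerivWithinAt (G j) (G (j + 1) t) K t

theorem IsDerivChain.mono {G : ℕ → ℝ → ℝ} {k l : ℕ} {K L : Set ℝ} (h : IsDerivChain G k K)
    (hl : l ≤ k) (hL : L ⊆ K) : IsDerivChain G l L :=
  fun j hj t ht => (h j (hj.trans_le hl) t (hL ht)).mono hL

theorem IsDerivChain.const_mul {G : ℕ → ℝ → ℝ} {k : ℕ} {K : Set ℝ} (h : IsDerivChain G k K)
    (c : ℝ) : IsDerivChain (fun j t => c * G j t) k K :=
  fun j hj t ht => (h j hj t ht).const_mul c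

theorem IsDerivChain.sub {G H : ℕ → ℝ → ℝ} {k : ℕ} {K : Set ℝ} (hG : IsDerivChain G k K)
    (hH : IsDerivChain H k K) : IsDerivChain (fun j t => G j t - H j t) k K :=
  fun j hj t ht => (hG j hj t ht).sub (hH j hj t ht)

theorem IsDerivChain.sum {ι : Type*} {s : Finset ι} {G : ι → ℕ → ℝ → ℝ} {k : ℕ} {K : Set ℝ}
    (h : ∀ i ∈ s, IsDerivChain (G i) k K) : IsDerivChain (fun j t => ∑ i ∈ s, G i j t) k K :=
  fun j hj t ht => HasDerivWithinAt.fun_sum fun i hi => h i hi j hj t ht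

theorem isDerivChain_polynomial (P : Polynomial ℝ) (k : ℕ) (K : Set ℝ) :
    IsDerivChain (fun j t => (Polynomial.derivative^[j] P).eval t) k K := by
  intro j _ t _
  simp only [Function.iterate_succ_apply']
  exact ((Polynomial.derivative^[j] P).hasDerivAt t).hasDerivWithinAt

/-- Iterated Rolle theorem. -/
theorem IsDerivChain.exists_eq_zero {p q : ℝ} {k : ℕ} {G : ℕ → ℝ → ℝ}
    (hG : IsDerivChain G k (Set.Icc p q)) {T : Finset ℝ} (hT : ∀ t ∈ T, t ∈ Set.Icc p q)
    (hz : ∀ t ∈ T, G 0 t = 0) (hk : k < #T) : ∃ ξ ∈ Set.Icc p q, G k ξ = 0 := by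
  induction k generalizing G T with
  | zero =>
    obtain ⟨t, ht⟩ := Finset.card_pos.1 hk
    exact ⟨t, hT t ht, hz t ht⟩
  | succ k ih =>
    have key : ∀ i : Fin (k + 1), ∃ ξ ∈ Set.Ioo (T.orderEmbOfCardLe hk i.castSucc)
        (T.orderEmbOfCardLe hk i.succ), G 1 ξ = 0 := by
      intro i
      have h1 := T.orderEmbOfCardLe_mem hk i.castSucc
      have h2 := T.orderEmbOfCardLe_mem hk i.succ
      have hsub : Set.Icc (T.orderEmbOfCardLe hk i.castSucc) (T.orderEmbOfCardLe hk i.succ) ⊆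
          Set.Icc p q := Set.Icc_subset_Icc (hT _ h1).1 (hT _ h2).2
      refine exists_hasDerivAt_eq_zero ((T.orderEmbOfCardLe hk).strictMono i.castSucc_lt_succ)
        (fun t ht => ((hG 0 k.succ_pos t (hsub ht)).continuousWithinAt).mono hsub)
        (by rw [hz _ h1, hz _ h2]) fun x hx => ?_
      exact (hG 0 k.succ_pos x (hsub ⟨hx.1.le, hx.2.le⟩)).hasDerivAt
        (Filter.mem_of_superset (Icc_mem_nhds hx.1 hx.2) hsub)
    choose ξ hξ hξ0 using key
    have hmono : StrictMono ξ := by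
      refine Fin.strictMono_iff_lt_succ.2 fun i => (hξ _).2.trans_le ?_
      exact (le_of_eq (by rw [Fin.succ_castSucc])).trans (hξ i.succ).1.le
    obtain ⟨x, hx, hx0⟩ := ih (G := fun j => G (j + 1)) (T := Finset.univ.image ξ)
      (fun j hj => hG (j + 1) (by omega)) (by
        simp only [mem_image, mem_univ, true_and, forall_exists_index, forall_apply_eq_imp_iff]
        intro i
        exact ⟨(hT _ (T.orderEmbOfCardLe_mem hk _)).1.trans (hξ i).1.le,
          (hξ i).2.le.trans (hT _ (T.orderEmbOfCardLe_mem hk _)).2⟩)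
      (by
        simp only [mem_image, mem_univ, true_and, forall_exists_index, forall_apply_eq_imp_iff]
        exact hξ0)
      (by rw [Finset.card_image_of_injective _ hmono.injective]; simp)
    exact ⟨x, hx, hx0⟩

/-- A function vanishing on a set `T` of `k` points is a multiple of the nodal polynomial of `T`,
the factor being a value of the `k`-th derivative divided by `k!`. -/
theorem IsDerivChain.exists_eq_mul_prod {p q : ℝ} {G : ℕ → ℝ → ℝ} {T : Finset ℝ}
    (hG : IsDerivChain G #T (Set.Icc p q)) (hT : ∀ t ∈ T, t ∈ Set.Icc p q)
    (hz : ∀ t ∈ T, G 0 t = 0) {u : ℝ} (hu : u ∈ Set.Icc p q) :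
    ∃ ξ ∈ Set.Icc p q, G 0 u = G #T ξ / (#T).factorial * ∏ t ∈ T, (u - t) := by
  by_cases huT : u ∈ T
  · exact ⟨u, hu, by rw [hz u huT, Finset.prod_eq_zero huT (sub_self u), mul_zero]⟩
  have hne : ∏ t ∈ T, (u - t) ≠ 0 := Finset.prod_ne_zero_iff.2 fun t ht h0 =>
    huT (by rwa [sub_eq_zero.1 h0])
  set P : Polynomial ℝ := ∏ t ∈ T, (Polynomial.X - Polynomial.C t) with hP
  have hPe (x : ℝ) : P.eval x = ∏ t ∈ T, (x - t) := by simp [hP, Polynomial.eval_prod]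
  have hPk (x : ℝ) : (Polynomial.derivative^[#T] P).eval x = (#T).factorial := by
    rw [hP, Polynomial.iterate_derivative_prod_X_sub_C le_rfl]
    simp
  obtain ⟨ξ, hξ, h0⟩ := (hG.sub ((isDerivChain_polynomial P _ _).const_mul
      (G 0 u / ∏ t ∈ T, (u - t)))).exists_eq_zero (T := insert u T)
    (by simpa [hu.1, hu.2] using hT)
    (by
      intro t ht
      rcases Finset.mem_insert.1 ht with rfl | ht
      · simp [hPe, div_mul_cancel₀ _ hne]
      · simp only [Function.iterate_zero, id_eq, hPe, hz t ht,
          Finset.prod_eq_zero ht (sub_self t), mul_zero, sub_zero])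
    (by rw [Finset.card_insert_of_notMem huT]; exact Nat.lt_succ_self _)
  refine ⟨ξ, hξ, ?_⟩
  have hf : ((#T).factorial : ℝ) ≠ 0 := by positivity
  simp only [hPk] at h0
  rw [sub_eq_zero.1 h0]
  field_simp

/-- Interpolation with control: if `g i` is a family of functions whose `j`-th derivative is close
to `δ_{ij}` then some combination with bounded coefficients vanishes at the `k` points of `T` and
has `k`-th derivative bounded below. -/
theorem exists_combination_vanishing {p q : ℝ} {T : Finset ℝ}
    (hT : ∀ t ∈ T, t ∈ Set.Icc p q) {g : Fin (#T + 1) → ℕ → ℝ → ℝ}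
    (hg : ∀ i, IsDerivChain (g i) #T (Set.Icc p q))
    (hδ : ∀ i j : Fin (#T + 1), ∀ t ∈ Set.Icc p q,
      |g i j t - if i = j then 1 else 0| ≤ 1 / (4 * (#T + 1))) :
    ∃ c : Fin (#T + 1) → ℝ, (∀ i, |c i| ≤ 1) ∧ (∀ t ∈ T, ∑ i, c i * g i 0 t = 0) ∧
      ∀ t ∈ Set.Icc p q, 1 / 2 ≤ ∑ i, c i * g i #T t := by
  have hsum : ∀ (c : Fin (#T + 1) → ℝ) (M : ℝ), (∀ i, |c i| ≤ M) → ∀ j : Fin (#T + 1),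
      ∀ t ∈ Set.Icc p q, |∑ i, c i * g i j t - c j| ≤ M / 4 := by
    intro c M hM j t ht
    have e : ∑ i, c i * g i j t - c j = ∑ i, c i * (g i j t - if i = j then 1 else 0) := by
      simp [mul_sub, Finset.sum_sub_distrib]
    rw [e]
    calc _ ≤ ∑ i, |c i * (g i j t - if i = j then 1 else 0)| := Finset.abs_sum_le_sum_abs _ _
      _ ≤ ∑ i : Fin (#T + 1), M * (1 / (4 * (#T + 1))) := by
        gcongr with i
        rw [abs_mul]
        exact mul_le_mul (hM i) (hδ i j t ht) (abs_nonneg _) ((abs_nonneg _).trans (hM i))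
      _ = M / 4 := by
        simp only [Finset.sum_const, Finset.card_univ, Fintype.card_fin, nsmul_eq_mul]
        push_cast
        field_simp
  obtain ⟨c, hc0, hcT⟩ : ∃ c : Fin (#T + 1) → ℝ, c ≠ 0 ∧
      ∀ t ∈ T, ∑ i, c i * g i 0 t = 0 := by
    let L : (Fin (#T + 1) → ℝ) →ₗ[ℝ] (T → ℝ) :=
      Matrix.mulVecLin (Matrix.of fun t i => g i 0 t)
    obtain ⟨c, hc, hc0⟩ := (Submodule.ne_bot_iff _).1
      (LinearMap.ker_ne_bot_of_finrank_lt (f := L) (by simp))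
    refine ⟨c, hc0, fun t ht => ?_⟩
    have := congrFun (LinearMap.mem_ker.1 hc) ⟨t, ht⟩
    simpa [L, Matrix.mulVec, dotProduct, mul_comm] using this
  obtain ⟨m, -, hm⟩ := Finset.exists_max_image Finset.univ (fun i => |c i|) Finset.univ_nonempty
  have hm0 : 0 < |c m| := by
    obtain ⟨i, hi⟩ := Function.ne_iff.1 hc0
    exact (abs_pos.2 hi).trans_le (hm i (Finset.mem_univ i))
  have hlast : m = Fin.last _ := by
    by_contra hne
    have hlt : (m : ℕ) < #T := Fin.val_lt_last hne
    obtain ⟨ξ, hξ, h0⟩ := ((IsDerivChain.sum (s := Finset.univ) fun i _ =>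
      (hg i).const_mul (c i)).mono hlt.le subset_rfl).exists_eq_zero hT hcT hlt
    have := hsum c _ (fun i => hm i (Finset.mem_univ i)) m ξ hξ
    rw [h0, zero_sub, abs_neg] at this
    linarith
  have hcm : c m ≠ 0 := abs_pos.1 hm0
  have hbd : ∀ i, |c i / c m| ≤ 1 := fun i => by
    rw [abs_div]
    exact (div_le_one hm0).2 (hm i (Finset.mem_univ i))
  refine ⟨fun i => c i / c m, hbd, fun t ht => ?_, fun t ht => ?_⟩
  · simp only [div_mul_eq_mul_div, ← Finset.sum_div, hcT t ht, zero_div]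
  · have := hsum (fun i => c i / c m) 1 hbd m t ht
    rw [div_self hcm] at this
    rw [hlast, Fin.val_last] at this
    rw [hlast]
    linarith [(abs_le.1 this).1]

/-- Essentially disjoint closed intervals are ordered like their centers. -/
theorem right_le_left_of_center_lt {a b a' b' : ℝ} (h : a ≤ b) (h' : a' ≤ b')
    (hd : Set.Icc a b ∩ Set.Icc a' b' ⊆ {a, b}) (hd' : Set.Icc a' b' ∩ Set.Icc a b ⊆ {a', b'})
    (hc : (a + b) / 2 < (a' + b') / 2) : b ≤ a' := by
  by_contra! hlt
  have hlt' : a < b' := by linarith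
  have hle : max a a' ≤ min b b' := by simp [h, h', hlt.le, hlt'.le]
  have hmem : ∀ x, max a a' ≤ x → x ≤ min b b' → (x = a ∨ x = b) ∧ (x = a' ∨ x = b') := by
    intro x h1 h2
    have h3 := max_le_iff.1 h1
    have h4 := le_min_iff.1 h2
    exact ⟨by simpa using hd ⟨⟨h3.1, h4.1⟩, h3.2, h4.2⟩,
      by simpa using hd' ⟨⟨h3.2, h4.2⟩, h3.1, h4.1⟩⟩
  have h1 := hmem (max a a') le_rfl hle
  have h2 := hmem (min b b') hle le_rfl
  have h3 := hmem ((max a a' + min b b') / 2) (by linarith) (by linarith)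
  grind

/-- For ordered intervals carrying real weights there is a product of at most `m` linear factors,
with roots at right endpoints, whose signs on the intervals agree with those of the weights. -/
theorem exists_prod_sub_sign {n : ℕ} {a b : Fin n → ℝ} (v : Fin n → ℝ) (hab : ∀ j, a j ≤ b j)
    (hord : ∀ i j, i < j → b i ≤ a j) (m : ℕ) (hm : m < n) :
    ∃ (T : Finset ℝ) (s : ℝ), |s| = 1 ∧ #T ≤ m ∧ (∀ t ∈ T, ∃ j : Fin n, (j : ℕ) < m ∧ b j = t) ∧
      ∀ j : Fin n, (j : ℕ) ≤ m → ∀ u ∈ Set.Ioo (a j) (b j), 0 ≤ s * v j * ∏ t ∈ T, (u - t) := by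
  induction m with
  | zero =>
    obtain ⟨s, hs, hsv⟩ : ∃ s : ℝ, |s| = 1 ∧ 0 ≤ s * v ⟨0, hm⟩ := by
      rcases le_total 0 (v ⟨0, hm⟩) with h | h
      · exact ⟨1, by simp, by simpa using h⟩
      · exact ⟨-1, by simp, by simpa using h⟩
    refine ⟨∅, s, hs, by simp, by simp, fun j hj u _ => ?_⟩
    rw [show j = ⟨0, hm⟩ from Fin.ext (by simpa using hj)]
    simpa using hsv
  | succ m ih =>
    obtain ⟨T, s, hs, hT, hTb, hpos⟩ := ih (by omega)
    set i₀ : Fin n := ⟨m, by omega⟩ with hi₀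
    set i₁ : Fin n := ⟨m + 1, hm⟩ with hi₁
    have hTlt : ∀ (T' : Finset ℝ), (∀ t ∈ T', ∃ j : Fin n, (j : ℕ) < m + 1 ∧ b j = t) →
        ∀ u ∈ Set.Ioo (a i₁) (b i₁), 0 ≤ ∏ t ∈ T', (u - t) := by
      intro T' hT' u hu
      refine Finset.prod_nonneg fun t ht => ?_
      obtain ⟨j, hj, rfl⟩ := hT' t ht
      have := hord j i₁ (Fin.lt_def.2 hj)
      linarith [hu.1]
    have hTb' : ∀ t ∈ T, ∃ j : Fin n, (j : ℕ) < m + 1 ∧ b j = t := fun t ht => by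
      obtain ⟨j, hj, hjt⟩ := hTb t ht
      exact ⟨j, by omega, hjt⟩
    by_cases hv : 0 ≤ s * v i₁
    · refine ⟨T, s, hs, by omega, hTb', fun j hj u hu => ?_⟩
      rcases Nat.le_succ_iff.1 hj with hj | hj
      · exact hpos j hj u hu
      · obtain rfl : j = i₁ := Fin.ext hj
        exact mul_nonneg hv (hTlt T hTb' u hu)
    · have hleft : ∀ j : Fin n, (j : ℕ) ≤ m → ∀ u ∈ Set.Ioo (a j) (b j), u < b i₀ := by
        intro j hj u hu
        rcases hj.lt_or_eq with hj | hj
        · exact hu.2.trans_le ((hord j i₀ (Fin.lt_def.2 hj)).trans (hab i₀))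
        · obtain rfl : j = i₀ := Fin.ext hj
          exact hu.2
      obtain ⟨T', hcard, hTb'', hprod⟩ : ∃ T' : Finset ℝ, #T' ≤ m + 1 ∧
          (∀ t ∈ T', ∃ j : Fin n, (j : ℕ) < m + 1 ∧ b j = t) ∧
          ∀ c u : ℝ, u < b i₀ → 0 ≤ c * ∏ t ∈ T, (u - t) → 0 ≤ -c * ∏ t ∈ T', (u - t) := by
        by_cases hmem : b i₀ ∈ T
        · refine ⟨T.erase (b i₀), (Finset.card_erase_le).trans (by omega),
            fun t ht => hTb' t (Finset.mem_of_mem_erase ht), fun c u hu h => ?_⟩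
          rw [← Finset.mul_prod_erase T _ hmem] at h
          by_contra! hneg
          nlinarith
        · refine ⟨insert (b i₀) T, (Finset.card_insert_le _ _).trans (by omega),
            fun t ht => ?_, fun c u hu h => ?_⟩
          · rcases Finset.mem_insert.1 ht with rfl | ht
            · exact ⟨i₀, by simp [hi₀], rfl⟩
            · exact hTb' t ht
          · rw [Finset.prod_insert hmem]
            nlinarith
      refine ⟨T', -s, by simpa using hs, hcard, hTb'', fun j hj u hu => ?_⟩
      rcases Nat.le_succ_iff.1 hj with hj | hj
      · have := hprod _ u (hleft j hj u hu) (hpos j hj u hu)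
        rwa [← neg_mul] at this
      · obtain rfl : j = i₁ := Fin.ext hj
        refine mul_nonneg ?_ (hTlt T' hTb'' u hu)
        rw [neg_mul]
        linarith

/-- Dual frames of a non-degenerate curve, uniformly close to being dual at nearby points. -/
theorem NonDegenerate.exists_dual_frame {n : ℕ} {γ : ℝ → (Fin n → ℝ)}
    (hγ : ContDiffOn ℝ n γ (Set.Icc 0 1)) (hnd : NonDegenerate n γ) {ε : ℝ} (hε : 0 < ε) :
    ∃ δ B : ℝ, 0 < δ ∧ 0 < B ∧ ∀ s ∈ Set.Icc (0 : ℝ) 1, ∃ N : Matrix (Fin n) (Fin n) ℝ,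
      (∀ i l, |N i l| ≤ B) ∧ ∀ t ∈ Set.Icc (0 : ℝ) 1, |t - s| ≤ δ → ∀ i j : Fin n,
        |∑ l, N i l * iteratedDerivWithin ((j : ℕ) + 1) γ (Set.Icc 0 1) t l -
          if i = j then 1 else 0| ≤ ε := by
  set I : Set ℝ := Set.Icc 0 1 with hI
  set M : ℝ → Matrix (Fin n) (Fin n) ℝ := fun t => Matrix.of fun (i j : Fin n) =>
      iteratedDerivWithin ((j : ℕ) + 1) γ I t i with hM
  have hMc : ContinuousOn M I := by
    refine continuousOn_pi.2 fun i => continuousOn_pi.2 fun j => ?_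
    have := hγ.continuousOn_iteratedDerivWithin (m := (j : ℕ) + 1)
      (by exact_mod_cast Nat.succ_le_of_lt j.2) (uniqueDiffOn_Icc zero_lt_one)
    exact (continuous_apply i).comp_continuousOn this
  set N : ℝ → Matrix (Fin n) (Fin n) ℝ := fun s => (M s).det⁻¹ • (M s).adjugate with hN
  have hNM : ∀ s ∈ I, N s * M s = 1 := by
    intro s hs
    rw [hN, smul_mul_assoc, Matrix.adjugate_mul, smul_smul, inv_mul_cancel₀ (hnd s hs), one_smul]
  have hNc : ContinuousOn N I := by
    refine ContinuousOn.smul (ContinuousOn.inv₀ ?_ fun s hs => hnd s hs) ?_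
    · exact (continuous_id.matrix_det).comp_continuousOn hMc
    · exact (continuous_id.matrix_adjugate).comp_continuousOn hMc
  have hcpt : IsCompact I := isCompact_Icc
  have hB : ∃ B : ℝ, 0 < B ∧ ∀ s ∈ I, ∀ i l, |N s i l| ≤ B := by
    have : ∀ i l, ∃ C, ∀ s ∈ I, ‖N s i l‖ ≤ C := fun i l =>
      hcpt.exists_bound_of_continuousOn (continuousOn_pi.1 (continuousOn_pi.1 hNc i) l)
    choose C hC using this
    refine ⟨1 + ∑ i, ∑ l, |C i l|, by positivity, fun s hs i l => ?_⟩
    calc |N s i l| ≤ C i l := hC i l s hs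
      _ ≤ |C i l| := le_abs_self _
      _ ≤ ∑ l, |C i l| :=
        Finset.single_le_sum (f := fun l => |C i l|) (fun _ _ => abs_nonneg _) (mem_univ l)
      _ ≤ ∑ i, ∑ l, |C i l| := Finset.single_le_sum (f := fun i => ∑ l, |C i l|)
        (fun _ _ => Finset.sum_nonneg fun _ _ => abs_nonneg _) (mem_univ i)
      _ ≤ _ := by linarith
  obtain ⟨B, hB0, hB⟩ := hB
  have hcont : ContinuousOn (fun x : ℝ × ℝ => fun i j => (N x.1 * M x.2) i j) (I ×ˢ I) := by
    have h1 : ContinuousOn (fun x : ℝ × ℝ => N x.1) (I ×ˢ I) :=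
      hNc.comp continuousOn_fst fun x hx => hx.1
    have h2 : ContinuousOn (fun x : ℝ × ℝ => M x.2) (I ×ˢ I) :=
      hMc.comp continuousOn_snd fun x hx => hx.2
    exact h1.mul h2
  obtain ⟨δ, hδ, hδ'⟩ := Metric.uniformContinuousOn_iff.1
    ((hcpt.prod hcpt).uniformContinuousOn_of_continuous hcont) ε hε
  refine ⟨δ / 2, B, by positivity, hB0, fun s hs => ⟨N s, hB s hs, fun t ht hts i j => ?_⟩⟩
  have := hδ' (s, t) ⟨hs, ht⟩ (s, s) ⟨hs, hs⟩ (by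
    rw [Prod.dist_eq, dist_self, Real.dist_eq, max_eq_right (abs_nonneg _)]
    linarith)
  have h2 : dist ((N s * M t) i j) ((N s * M s) i j) ≤ ε :=
    ((dist_le_pi_dist (fun j => (N s * M t) i j) (fun j => (N s * M s) i j) j).trans
      (dist_le_pi_dist (fun i j => (N s * M t) i j) (fun i j => (N s * M s) i j) i)).trans this.le
  simp only [hNM s hs, Real.dist_eq] at h2
  rwa [Matrix.mul_apply, Matrix.one_apply] at h2

/-- On short intervals, every product of fewer than `n` distinct linear factors is comparable to a
component of the velocity of a non-degenerate curve in a bounded direction. -/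
theorem NonDegenerate.exists_direction {n : ℕ} {γ : ℝ → (Fin n → ℝ)}
    (hγ : ContDiffOn ℝ n γ (Set.Icc 0 1)) (hnd : NonDegenerate n γ) :
    ∃ δ C c : ℝ, 0 < δ ∧ 0 < C ∧ 0 < c ∧ ∀ p q : ℝ, Set.Icc p q ⊆ Set.Icc 0 1 → p ≤ q →
      q - p ≤ δ → ∀ T : Finset ℝ, (∀ t ∈ T, t ∈ Set.Icc p q) → #T < n →
      ∃ w : Fin n → ℝ, (∀ l, |w l| ≤ C) ∧ ∀ u ∈ Set.Icc p q, ∃ r, c ≤ r ∧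
        ∑ l, w l * derivWithin γ (Set.Icc 0 1) u l = r * ∏ t ∈ T, (u - t) := by
  obtain ⟨δ, B, hδ, hB, hframe⟩ := hnd.exists_dual_frame hγ (ε := 1 / (4 * (n + 1)))
    (by positivity)
  refine ⟨δ, (n + 1) * B, 1 / (2 * n.factorial), hδ, by positivity, by positivity, ?_⟩
  intro p q hsub hpq hqp T hT hTn
  obtain ⟨N, hNB, hN⟩ := hframe p (hsub ⟨le_rfl, hpq⟩)
  set e : Fin (#T + 1) → Fin n := Fin.castLE hTn with he
  set g : Fin (#T + 1) → ℕ → ℝ → ℝ := fun i j t =>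
    ∑ l, N (e i) l * iteratedDerivWithin (j + 1) γ (Set.Icc 0 1) t l with hg
  have hchain : ∀ i, IsDerivChain (g i) #T (Set.Icc p q) := by
    intro i
    refine IsDerivChain.sum fun l _ => IsDerivChain.const_mul (fun j hj t ht => ?_) _
    have hd := (hγ.differentiableOn_iteratedDerivWithin (m := j + 1)
      (by exact_mod_cast (by omega : j + 1 < n)) (uniqueDiffOn_Icc zero_lt_one)
      t (hsub ht)).hasDerivWithinAt
    rw [← iteratedDerivWithin_succ] at hd
    exact (hasDerivWithinAt_pi.1 hd l).mono hsub
  obtain ⟨c, hc1, hcT, hck⟩ := exists_combination_vanishing hT hchain (by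
    intro i j t ht
    have := hN t (hsub ht) (by rw [abs_of_nonneg (by linarith [ht.1])]; linarith [ht.2])
      (e i) (e j)
    simp only [he, (Fin.castLE_injective hTn).eq_iff] at this
    refine this.trans ?_
    have : (#T : ℝ) ≤ n := by exact_mod_cast hTn.le
    gcongr)
  have hG : IsDerivChain (fun j t => ∑ i, c i * g i j t) #T (Set.Icc p q) :=
    IsDerivChain.sum fun i _ => (hchain i).const_mul (c i)
  refine ⟨fun l => ∑ i, c i * N (e i) l, fun l => ?_, fun u hu => ?_⟩
  · calc |∑ i, c i * N (e i) l| ≤ ∑ i, |c i * N (e i) l| := Finset.abs_sum_le_sum_abs _ _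
      _ ≤ ∑ i : Fin (#T + 1), 1 * B := by
        gcongr with i
        rw [abs_mul]
        exact mul_le_mul (hc1 i) (hNB _ _) (abs_nonneg _) zero_le_one
      _ = (#T + 1) * B := by simp
      _ ≤ (n + 1) * B := by
        have : (#T : ℝ) ≤ n := by exact_mod_cast hTn.le
        gcongr
  · obtain ⟨ξ, hξ, h⟩ := hG.exists_eq_mul_prod hT hcT hu
    refine ⟨_, ?_, Eq.trans ?_ h⟩
    · have h1 := hck ξ hξ
      have h2 : ((#T).factorial : ℝ) ≤ n.factorial := by
        exact_mod_cast Nat.factorial_le hTn.le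
      rw [← div_div]
      gcongr
    · simp only [hg, zero_add, iteratedDerivWithin_one, Finset.mul_sum, Finset.sum_mul]
      rw [Finset.sum_comm]
      simp only [mul_assoc]

/-- Lower bound for the integral of a function that is non-negative on an interval and bounded
below on its middle half. -/
theorem mul_half_length_le_setIntegral {a b m : ℝ} {φ : ℝ → ℝ} (hab : a < b)
    (hint : IntegrableOn φ (Set.Icc a b)) (h0 : ∀ u ∈ Set.Ioo a b, 0 ≤ φ u)
    (hm : ∀ u ∈ Set.Icc (a + (b - a) / 4) (b - (b - a) / 4), m ≤ φ u) :
    m * ((b - a) / 2) ≤ ∫ u in Set.Icc a b, φ u := by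
  have hsub : Set.Icc (a + (b - a) / 4) (b - (b - a) / 4) ⊆ Set.Ioo a b := fun u hu =>
    ⟨by linarith [hu.1], by linarith [hu.2]⟩
  have hint' : IntegrableOn φ (Set.Ioo a b) := hint.mono_set Set.Ioo_subset_Icc_self
  rw [integral_Icc_eq_integral_Ioo]
  calc m * ((b - a) / 2) = m * volume.real (Set.Icc (a + (b - a) / 4) (b - (b - a) / 4)) := by
        rw [Real.volume_real_Icc_of_le (by linarith)]
        ring
    _ ≤ ∫ u in Set.Icc (a + (b - a) / 4) (b - (b - a) / 4), φ u :=
        setIntegral_ge_of_const_le_real measurableSet_Icc (by simp) hm (hint'.mono_set hsub)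
    _ ≤ _ := setIntegral_mono_set hint'
        ((ae_restrict_iff' measurableSet_Ioo).2 (Filter.Eventually.of_forall h0)) hsub.eventuallyLE

/-- The Euclidean norm bounds the pairing with a vector having bounded entries. -/
theorem abs_sum_mul_le_card_mul_sqrt {n : ℕ} {C : ℝ} {w : Fin n → ℝ} (hw : ∀ l, |w l| ≤ C)
    (x : Fin n → ℝ) : |∑ l, w l * x l| ≤ n * C * Real.sqrt (∑ l, x l ^ 2) := by
  calc |∑ l, w l * x l| ≤ ∑ l, |w l * x l| := Finset.abs_sum_le_sum_abs _ _
    _ ≤ ∑ _l : Fin n, C * Real.sqrt (∑ l, x l ^ 2) := by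
      gcongr with l
      rw [abs_mul]
      refine mul_le_mul (hw l) (Real.abs_le_sqrt ?_) (abs_nonneg _) ((abs_nonneg _).trans (hw l))
      exact Finset.single_le_sum (f := fun l => x l ^ 2) (fun _ _ => sq_nonneg _) (mem_univ l)
    _ = n * C * Real.sqrt (∑ l, x l ^ 2) := by simp [mul_assoc]

/-- Proposition 4.2 (c): if some interval `J_{j₀} = [a j₀, b j₀]` has length at
least `c₁/R` and `|v_{j₀}| ≥ 1`, then `|A v| ≥ R^{-n}` (Euclidean norm), where
the `j`-th column of `A` is `∫_{J_j} γ'(u) |Ξ(u)| du`. -/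
theorem det_avg_mulVec_lower_bound (n : ℕ) (γ : ℝ → (Fin n → ℝ))
    (hγ : ContDiffOn ℝ n γ (Set.Icc 0 1)) (hnd : NonDegenerate n γ) :
    ∃ δ₀ c₁ : ℝ, 0 < δ₀ ∧ 1 ≤ c₁ ∧
      ∀ (a b : Fin n → ℝ) (Ξ : ℝ → ℝ),
      (∀ j, a j ≤ b j) →
      (∀ j, Set.Icc (a j) (b j) ⊆ Set.Icc 0 1) →
      (∀ i j, i ≠ j →
        Set.Icc (a i) (b i) ∩ Set.Icc (a j) (b j) ⊆ {a i, b i}) →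
      StrictMono (fun j => (a j + b j) / 2) →
      Metric.diam (⋃ j, Set.Icc (a j) (b j)) ≤ δ₀ →
      Measurable Ξ →
      (∀ t, t ∉ ⋃ j, Set.Icc (a j) (b j) → Ξ t = 0) →
      (∀ t ∈ ⋃ j, Set.Icc (a j) (b j), 1 ≤ |Ξ t| ∧ |Ξ t| ≤ n) →
      ∀ R : ℝ, 1 ≤ R → ∀ j₀ : Fin n, c₁ / R ≤ b j₀ - a j₀ →
      ∀ v : Fin n → ℝ, 1 ≤ |v j₀| →
      (R ^ n)⁻¹ ≤ Real.sqrt (∑ k, ((Matrix.of fun (k j : Fin n) =>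
          ∫ u in Set.Icc (a j) (b j),
            derivWithin γ (Set.Icc 0 1) u k * |Ξ u|).mulVec v k) ^ 2) := by
  rcases n with _ | N
  · exact ⟨1, 1, one_pos, le_rfl, fun _ _ _ _ _ _ _ _ _ _ _ _ _ j₀ => j₀.elim0⟩
  obtain ⟨δ, C, c, hδ, hC, hc, hdir⟩ := hnd.exists_direction hγ
  set D : ℝ := (N + 1 : ℕ) * C * 4 ^ (N + 1) / c with hD
  refine ⟨δ, max 1 D, hδ, le_max_left _ _, ?_⟩
  intro a b Ξ hab hsub hdisj hcen hdiam hΞm _ hΞ R hR j₀ hlen v hv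
  have hord : ∀ i j, i < j → b i ≤ a j := fun i j hij =>
    right_le_left_of_center_lt (hab i) (hab j) (hdisj i j hij.ne) (hdisj j i hij.ne') (hcen hij)
  have hfirst : ∀ j, a 0 ≤ a j := fun j => by
    rcases (Fin.zero_le j).eq_or_lt with rfl | h
    · exact le_rfl
    · exact (hab 0).trans (hord 0 j h)
  have hlast : ∀ j, b j ≤ b (Fin.last N) := fun j => by
    rcases (Fin.le_last j).eq_or_lt with rfl | h
    · exact le_rfl
    · exact (hord j _ h).trans (hab _)
  have hpq : a 0 ≤ b (Fin.last N) := (hab 0).trans (hlast 0)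
  have hp : a 0 ∈ Set.Icc (0 : ℝ) 1 := hsub 0 ⟨le_rfl, hab 0⟩
  have hq : b (Fin.last N) ∈ Set.Icc (0 : ℝ) 1 := hsub _ ⟨hab _, le_rfl⟩
  have hqp : b (Fin.last N) - a 0 ≤ δ := by
    have hbdd : Bornology.IsBounded (⋃ j, Set.Icc (a j) (b j)) :=
      (Metric.isBounded_Icc (0 : ℝ) 1).subset (Set.iUnion_subset hsub)
    have := (Metric.dist_le_diam_of_mem hbdd
      (Set.mem_iUnion.2 ⟨Fin.last N, ⟨hab (Fin.last N), le_rfl⟩⟩)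
      (Set.mem_iUnion.2 ⟨0, ⟨le_rfl, hab 0⟩⟩)).trans hdiam
    exact (le_abs_self _).trans this
  obtain ⟨T, s, hs, hTN, hTb, hsign⟩ := exists_prod_sub_sign v hab hord N (Nat.lt_succ_self N)
  obtain ⟨w, hw, hwG⟩ := hdir (a 0) (b (Fin.last N)) (Set.Icc_subset_Icc hp.1 hq.2) hpq hqp T
    (fun t ht => by
      obtain ⟨j, -, rfl⟩ := hTb t ht
      exact ⟨(hfirst j).trans (hab j), hlast j⟩) (Nat.lt_succ_of_le hTN)
  have hsubK : ∀ j, Set.Icc (a j) (b j) ⊆ Set.Icc (a 0) (b (Fin.last N)) := fun j =>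
    Set.Icc_subset_Icc (hfirst j) (hlast j)
  set φ : Fin (N + 1) → ℝ → ℝ := fun j u =>
    s * v j * (∑ l, w l * derivWithin γ (Set.Icc 0 1) u l) * |Ξ u| with hφ
  have hint : ∀ j l, IntegrableOn (fun u => derivWithin γ (Set.Icc 0 1) u l * |Ξ u|)
      (Set.Icc (a j) (b j)) := by
    intro j l
    have hcont : ContinuousOn (derivWithin γ (Set.Icc 0 1)) (Set.Icc 0 1) :=
      hγ.continuousOn_derivWithin (uniqueDiffOn_Icc zero_lt_one)
        (by exact_mod_cast Nat.succ_le_succ N.zero_le)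
    have h1 : IntegrableOn (fun u => derivWithin γ (Set.Icc 0 1) u l) (Set.Icc (a j) (b j)) :=
      (((continuous_apply l).comp_continuousOn hcont).mono (hsub j)).integrableOn_Icc
    refine Integrable.mul_bdd (c := ((N + 1 : ℕ) : ℝ)) h1 hΞm.abs.aestronglyMeasurable ?_
    refine (ae_restrict_iff' measurableSet_Icc).2 (Filter.Eventually.of_forall fun u hu => ?_)
    simpa using (hΞ u (Set.mem_iUnion.2 ⟨j, hu⟩)).2
  have hφeq : ∀ j, φ j = fun u => s * v j *
      ∑ l, w l * (derivWithin γ (Set.Icc 0 1) u l * |Ξ u|) := fun j => by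
    funext u
    simp only [hφ, mul_assoc, Finset.sum_mul]
  have hφint : ∀ j, IntegrableOn (φ j) (Set.Icc (a j) (b j)) := fun j => by
    rw [hφeq]
    exact (integrable_finsetSum _ fun l _ => (hint j l).const_mul (w l)).const_mul _
  have hφ0 : ∀ j, ∀ u ∈ Set.Ioo (a j) (b j), 0 ≤ φ j u := by
    intro j u hu
    obtain ⟨r, hr, hG⟩ := hwG u (hsubK j ⟨hu.1.le, hu.2.le⟩)
    have h1 := hsign j (Nat.lt_succ_iff.1 j.2) u hu
    simp only [hφ, hG]
    have : s * v j * (r * ∏ t ∈ T, (u - t)) * |Ξ u| =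
      (s * v j * ∏ t ∈ T, (u - t)) * (r * |Ξ u|) := by ring
    rw [this]
    exact mul_nonneg h1 (mul_nonneg (hc.le.trans hr) (abs_nonneg _))
  set L : ℝ := b j₀ - a j₀ with hL
  have hR0 : 0 < R := one_pos.trans_le hR
  have hmax : 1 ≤ max 1 D := le_max_left _ _
  have hL0 : 0 < L := (div_pos (one_pos.trans_le hmax) hR0).trans_le hlen
  have hL1 : L ≤ 1 := by
    have h1 := (hsub j₀ ⟨le_rfl, hab j₀⟩).1
    have h2 := (hsub j₀ ⟨hab j₀, le_rfl⟩).2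
    linarith
  have hφm : ∀ u ∈ Set.Icc (a j₀ + L / 4) (b j₀ - L / 4), c * (L / 4) ^ N ≤ φ j₀ u := by
    intro u hu
    have hu' : u ∈ Set.Ioo (a j₀) (b j₀) := ⟨by linarith [hu.1], by linarith [hu.2]⟩
    have huI : u ∈ Set.Icc (a j₀) (b j₀) := ⟨hu'.1.le, hu'.2.le⟩
    obtain ⟨r, hr, hG⟩ := hwG u (hsubK j₀ huI)
    have hprod : (L / 4) ^ N ≤ |∏ t ∈ T, (u - t)| := by
      calc (L / 4) ^ N ≤ (L / 4) ^ #T :=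
            pow_le_pow_of_le_one (by positivity) (by linarith) hTN
        _ = ∏ t ∈ T, L / 4 := (Finset.prod_const _).symm
        _ ≤ ∏ t ∈ T, |u - t| := by
            refine Finset.prod_le_prod (fun _ _ => by positivity) fun t ht => ?_
            obtain ⟨j, -, rfl⟩ := hTb t ht
            rcases lt_trichotomy j j₀ with h | rfl | h
            · exact le_abs.2 (Or.inl (by linarith [hord j j₀ h, hu.1]))
            · exact le_abs.2 (Or.inr (by linarith [hu.2]))
            · exact le_abs.2 (Or.inr (by linarith [hord j₀ j h, hab j, hu.2]))
        _ = _ := (Finset.abs_prod _ _).symm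
    have hΞu := (hΞ u (Set.mem_iUnion.2 ⟨j₀, huI⟩)).1
    rw [← abs_of_nonneg (hφ0 j₀ u hu')]
    simp only [hφ, hG, abs_mul, hs, one_mul, abs_abs]
    calc c * (L / 4) ^ N = 1 * (c * (L / 4) ^ N) * 1 := by ring
      _ ≤ |v j₀| * (|r| * |∏ t ∈ T, (u - t)|) * |Ξ u| := by
        gcongr
        exact hr.trans (le_abs_self r)
  set A : Matrix (Fin (N + 1)) (Fin (N + 1)) ℝ := Matrix.of fun k j =>
    ∫ u in Set.Icc (a j) (b j), derivWithin γ (Set.Icc 0 1) u k * |Ξ u| with hA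
  have hpair : s * ∑ k, w k * A.mulVec v k = ∑ j, ∫ u in Set.Icc (a j) (b j), φ j u := by
    have h1 : ∀ j, ∫ u in Set.Icc (a j) (b j), φ j u = s * v j * ∑ l, w l * A l j := fun j => by
      rw [hφeq, integral_const_mul, integral_finsetSum _ fun l _ => (hint j l).const_mul (w l)]
      simp only [integral_const_mul, hA, Matrix.of_apply]
    simp only [h1, Matrix.mulVec, dotProduct, Finset.mul_sum]
    rw [Finset.sum_comm]
    exact Finset.sum_congr rfl fun _ _ => Finset.sum_congr rfl fun _ _ => by ring
  have hlow : c * (L / 4) ^ (N + 1) ≤ |∑ k, w k * A.mulVec v k| := by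
    calc c * (L / 4) ^ (N + 1) ≤ c * (L / 4) ^ N * (L / 2) := by
          rw [pow_succ, ← mul_assoc]
          gcongr
          norm_num
      _ ≤ ∫ u in Set.Icc (a j₀) (b j₀), φ j₀ u :=
          mul_half_length_le_setIntegral (by linarith) (hφint j₀) (hφ0 j₀) hφm
      _ ≤ ∑ j, ∫ u in Set.Icc (a j) (b j), φ j u := by
          refine Finset.single_le_sum (f := fun j => ∫ u in Set.Icc (a j) (b j), φ j u)
            (fun j _ => ?_) (mem_univ j₀)
          rw [integral_Icc_eq_integral_Ioo]
          exact setIntegral_nonneg measurableSet_Ioo (hφ0 j)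
      _ ≤ |s * ∑ k, w k * A.mulVec v k| := hpair ▸ le_abs_self _
      _ = _ := by rw [abs_mul, hs, one_mul]
  have hup := abs_sum_mul_le_card_mul_sqrt hw (A.mulVec v)
  have hDL : D * (R ^ (N + 1))⁻¹ ≤ L ^ (N + 1) := by
    calc D * (R ^ (N + 1))⁻¹ ≤ (max 1 D) ^ (N + 1) * (R ^ (N + 1))⁻¹ := by
          gcongr
          exact (le_max_right _ _).trans (le_self_pow₀ hmax N.succ_ne_zero)
      _ = (max 1 D / R) ^ (N + 1) := by rw [div_pow, div_eq_mul_inv]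
      _ ≤ L ^ (N + 1) := by gcongr
  have hnC : (0 : ℝ) < (N + 1 : ℕ) * C := by positivity
  refine le_of_mul_le_mul_left ?_ hnC
  refine le_trans ?_ (hlow.trans hup)
  calc (N + 1 : ℕ) * C * (R ^ (N + 1))⁻¹ = c * (D * (R ^ (N + 1))⁻¹) / 4 ^ (N + 1) := by
        rw [hD]
        field_simp
    _ ≤ c * L ^ (N + 1) / 4 ^ (N + 1) := by gcongr
    _ = c * (L / 4) ^ (N + 1) := by rw [div_pow, mul_div_assoc]
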